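/- Let G be a connected graph with v(G) = k ≥ 2 vertices, and suppose Assumption 1 holds for the subgraph count N_G. Then there exists a constant C > 0, independent of n, such that for all n ≥ 2k−1, Var(N_G) ≥ (C/a(G)²) · ( (n!/(n−2k+1)!) p_n^{2e(G)} + (n!/(n−k)!) p_n^{e(G)} ). -/

import Mathlib

open MeasureTheory Finset ProbabilityTheory

/-- The joint cumulant, via the moment–cumulant formula. -/
noncomputable def jointCumulant {Ω : Type*} [MeasurableSpace Ω] (P : Measure Ω)
    {j : ℕ} (Z : Fin j → Ω → ℝ) : ℝ :=
  ∑ σ : Finpartition (Finset.univ : Finset (Fin j)),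
    (-1 : ℝ) ^ (σ.parts.card - 1) * ((σ.parts.card - 1).factorial : ℝ) *
      ∏ b ∈ σ.parts, ∫ ω, ∏ i ∈ b, Z i ω ∂P

/-- The `j`-th cumulant `κ_j(W)` of a random variable `W`. -/
noncomputable def cum {Ω : Type*} [MeasurableSpace Ω] (P : Measure Ω)
    (j : ℕ) (W : Ω → ℝ) : ℝ :=
  jointCumulant P (fun _ : Fin j => W)

/-- The size `a(G)` of the automorphism group of `G`. -/
noncomputable def autCard {k : ℕ} (G : SimpleGraph (Fin k)) : ℕ := Nat.card (G ≃g G)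

/-- The injective subgraph count `N_G` in the binomial random-connection model:
vertices `X_1,…,X_n`, and `X_i ∼ X_j` iff `Y_{i,j} ≤ p_n H(X_i,X_j)` where the
`Y_{i,j}` are i.i.d. uniform on `[0,1]`. -/
noncomputable def NG {d k n : ℕ} {Ω : Type*} (G : SimpleGraph (Fin k)) [DecidableRel G.Adj]
    (H : (Fin d → ℝ) → (Fin d → ℝ) → ℝ) (pn : ℝ) (aG : ℕ)
    (X : Fin n → Ω → (Fin d → ℝ)) (Y : Fin n → Fin n → Ω → ℝ) (ω : Ω) : ℝ :=
  (aG : ℝ)⁻¹ * ∑ β ∈ (Finset.univ : Finset (Fin k → Fin n)).filter Function.Injective,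
    ∏ q ∈ (Finset.univ : Finset (Fin k × Fin k)).filter (fun q => q.1 < q.2 ∧ G.Adj q.1 q.2),
      if Y (β q.1) (β q.2) ω ≤ pn * H (X (β q.1) ω) (X (β q.2) ω) then (1 : ℝ) else 0

/-- The projection `f_{(ℓ)}` of the subgraph-count functional:
`f_{(ℓ)}(x) = (p^{e(G)}/a(G)) ∫ ∏_{(ı,ȷ)∈E_G} H(x_ı,x_ȷ) dμ^{⊗(k−1)}` with `x_ℓ = x`
(the unused `ℓ`-th coordinate is also integrated out, which is harmless since `μ` is a
probability measure). -/
noncomputable def fSub {d k : ℕ} (G : SimpleGraph (Fin k)) [DecidableRel G.Adj]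
    (H : (Fin d → ℝ) → (Fin d → ℝ) → ℝ) (μ : Measure (Fin d → ℝ)) (pn : ℝ) (aG : ℕ)
    (ℓ : Fin k) (x : Fin d → ℝ) : ℝ :=
  (pn ^ G.edgeFinset.card / (aG : ℝ)) *
    ∫ z : Fin k → (Fin d → ℝ),
      ∏ q ∈ (Finset.univ : Finset (Fin k × Fin k)).filter
          (fun q => q.1 < q.2 ∧ G.Adj q.1 q.2),
        H (Function.update z ℓ x q.1) (Function.update z ℓ x q.2)
      ∂(Measure.pi fun _ => μ)

/-- A graph `G` is strongly balanced if `e(H)/(v(H)−1) ≤ e(G)/(v(G)−1)` for every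
subgraph `H` of `G` with at least two vertices. -/
def StronglyBalanced {k : ℕ} (G : SimpleGraph (Fin k)) [DecidableRel G.Adj] : Prop :=
  ∀ Hs : G.Subgraph, 2 ≤ Hs.verts.ncard →
    Hs.edgeSet.ncard * (k - 1) ≤ G.edgeFinset.card * (Hs.verts.ncard - 1)

section ProductMeasure

variable {α : Type*} [MeasurableSpace α]

theorem measurePreserving_update_pi {ι : Type*} [Fintype ι] [DecidableEq ι]
    (μ : Measure α) [IsProbabilityMeasure μ] (i : ι) :
    MeasurePreserving (fun z : α × (ι → α) => Function.update z.2 i z.1)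
      (μ.prod (Measure.pi fun _ => μ)) (Measure.pi fun _ => μ) := by
  have hm : Measurable (fun z : α × (ι → α) => Function.update z.2 i z.1) :=
    measurable_update'.comp measurable_swap
  refine ⟨hm, (Measure.pi_eq fun s hs => ?_).symm⟩
  rw [Measure.map_apply hm (MeasurableSet.univ_pi hs)]
  have : (fun z : α × (ι → α) => Function.update z.2 i z.1) ⁻¹' Set.univ.pi s
      = s i ×ˢ Set.univ.pi (Function.update s i Set.univ) := by
    ext z
    simp only [Set.mem_preimage, Set.mem_pi, Set.mem_univ, true_imp_iff, Set.mem_prod]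
    constructor
    · refine fun h => ⟨by simpa using h i, fun j => ?_⟩
      rcases eq_or_ne j i with rfl | hj
      · simp
      · simpa [hj] using h j
    · rintro ⟨h1, h2⟩ j
      rcases eq_or_ne j i with rfl | hj
      · simpa using h1
      · simpa [hj] using h2 j
  rw [this, Measure.prod_prod, Measure.pi_pi,
    ← Finset.mul_prod_erase Finset.univ (fun j => μ (s j)) (Finset.mem_univ i),
    ← Finset.mul_prod_erase Finset.univ _ (Finset.mem_univ i)]
  simp only [Function.update_self, measure_univ, one_mul]
  congr 1
  refine Finset.prod_congr rfl fun j hj => ?_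
  rw [Function.update_of_ne (Finset.ne_of_mem_erase hj)]

theorem measurePreserving_comp_injective {ι κ : Type*} [Fintype ι] [Fintype κ]
    (μ : Measure α) [IsProbabilityMeasure μ] {β : κ → ι} (hβ : Function.Injective β) :
    MeasurePreserving (fun (x : ι → α) j => x (β j))
      (Measure.pi fun _ => μ) (Measure.pi fun _ => μ) := by
  refine ⟨by fun_prop, ?_⟩
  have h := (iIndepFun_pi (μ := fun _ : ι => μ) (X := fun _ => id)
    fun _ => aemeasurable_id).precomp hβ
  rw [iIndepFun_iff_map_fun_eq_pi_map (f := fun j (ω : ι → α) => id (ω (β j)))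
    fun j => (measurable_pi_apply (β j)).aemeasurable] at h
  simpa [Measure.pi_map_eval, Function.comp_def, Function.eval,
    (measurePreserving_eval (fun _ : ι => μ) _).map_eq] using h

theorem integral_pi_update {ι : Type*} [Fintype ι] [DecidableEq ι]
    (μ : Measure α) [IsProbabilityMeasure μ] (i : ι) {φ : (ι → α) → ℝ}
    (hφ : Measurable φ) {C : ℝ} (hC : ∀ z, ‖φ z‖ ≤ C) :
    ∫ x, ∫ z, φ (Function.update z i x) ∂(Measure.pi fun _ => μ) ∂μ
      = ∫ z, φ z ∂(Measure.pi fun _ => μ) := by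
  have hmp := measurePreserving_update_pi μ i
  rw [← hmp.map_eq, integral_map hmp.measurable.aemeasurable hφ.aestronglyMeasurable,
    integral_prod]
  · simp_rw [hmp.map_eq]
  · exact Integrable.of_bound (hφ.comp hmp.measurable).aestronglyMeasurable C
      (ae_of_all _ fun z => hC _)

theorem measurable_integral_update {ι : Type*} [Fintype ι] [DecidableEq ι]
    (μ : Measure α) [IsProbabilityMeasure μ] (i : ι) {φ : (ι → α) → ℝ}
    (hφ : Measurable φ) :
    Measurable fun x => ∫ z, φ (Function.update z i x) ∂(Measure.pi fun _ => μ) := by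
  have h : Measurable fun z : α × (ι → α) => φ (Function.update z.2 i z.1) :=
    hφ.comp (measurePreserving_update_pi μ i).measurable
  exact (h.stronglyMeasurable.integral_prod_right' (ν := Measure.pi fun _ => μ)).measurable

theorem norm_integral_le_of_bound {γ : Type*} [MeasurableSpace γ] (ν : Measure γ)
    [IsProbabilityMeasure ν] {f : γ → ℝ} {C : ℝ} (hC : ∀ z, ‖f z‖ ≤ C) :
    ‖∫ z, f z ∂ν‖ ≤ C := by
  simpa using norm_integral_le_of_norm_le_const (μ := ν) (ae_of_all _ hC)

theorem memLp_two_of_bound {γ : Type*} [MeasurableSpace γ] (ν : Measure γ)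
    [IsProbabilityMeasure ν] {f : γ → ℝ} (hf : Measurable f) {C : ℝ} (hC : ∀ z, ‖f z‖ ≤ C) :
    MemLp f 2 ν :=
  MemLp.of_bound hf.aestronglyMeasurable C (ae_of_all _ hC)

theorem covariance_pi_eval {ι : Type*} [Fintype ι] [DecidableEq ι]
    (μ : Measure α) [IsProbabilityMeasure μ] (i : ι) {φ : (ι → α) → ℝ} {ψ : α → ℝ}
    (hφ : Measurable φ) {C : ℝ} (hC : ∀ z, ‖φ z‖ ≤ C)
    (hψ : Measurable ψ) {D : ℝ} (hD : ∀ x, ‖ψ x‖ ≤ D) :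
    cov[φ, fun z => ψ (z i); Measure.pi fun _ => μ]
      = cov[fun x => ∫ z, φ (Function.update z i x) ∂(Measure.pi fun _ => μ), ψ; μ] := by
  have hψi : Measurable fun z : ι → α => ψ (z i) := hψ.comp (measurable_pi_apply i)
  rw [covariance_eq_sub (memLp_two_of_bound _ hφ hC)
      (memLp_two_of_bound _ hψi fun z => hD _),
    covariance_eq_sub (memLp_two_of_bound _ (measurable_integral_update μ i hφ)
      fun x => norm_integral_le_of_bound _ fun z => hC _) (memLp_two_of_bound _ hψ hD)]
  have h1 := integral_pi_update μ i (hφ.mul hψi) (C := C * D) (fun z => by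
    rw [Pi.mul_apply, norm_mul]
    exact mul_le_mul (hC _) (hD _) (norm_nonneg _) ((norm_nonneg _).trans (hC z)))
  have h2 := integral_pi_update μ i hφ hC
  have h3 := integral_pi_update μ i hψi (C := D) (fun z => hD _)
  simp only [Pi.mul_apply, Function.update_self, integral_mul_const, integral_const,
    probReal_univ, one_smul] at h1 h2 h3 ⊢
  rw [h1, h2, h3]

end ProductMeasure

section VarianceBounds

theorem variance_prod_ge_of_condMoments {γ δ ι : Type*} [MeasurableSpace γ] [MeasurableSpace δ]
    (ν : Measure γ) [IsProbabilityMeasure ν] (lam : Measure δ) [IsProbabilityMeasure lam]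
    (B : Finset ι) (S : ι → γ → δ → ℝ) (m : ι → γ → ℝ)
    (hS : ∀ b, Measurable fun z : γ × δ => S b z.1 z.2) (hS1 : ∀ b x y, ‖S b x y‖ ≤ 1)
    (hSS : ∀ b x y, S b x y * S b x y = S b x y)
    (hm : ∀ b, b ∈ B → ∀ x, ∫ y, S b x y ∂lam = m b x)
    (hmm : ∀ b ∈ B, ∀ c ∈ B, ∀ x, m b x * m c x ≤ ∫ y, S b x y * S c x y ∂lam) :
    Var[fun x => ∑ b ∈ B, m b x; ν] + ∑ b ∈ B, ∫ x, (m b x - m b x ^ 2) ∂ν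
      ≤ Var[fun z : γ × δ => ∑ b ∈ B, S b z.1 z.2; ν.prod lam] := by
  classical
  have hSx : ∀ b x, Measurable (S b x) := fun b x => (hS b).comp measurable_prodMk_left
  have hmB : ∀ b ∈ B, Measurable (m b) := fun b hb => by
    have := ((hS b).stronglyMeasurable.integral_prod_right' (ν := lam)).measurable
    simpa only [hm b hb] using this
  have hm1 : ∀ b ∈ B, ∀ x, ‖m b x‖ ≤ 1 := fun b hb x => by
    rw [← hm b hb x]; exact norm_integral_le_of_bound _ fun y => hS1 b x y
  have hSint : ∀ b c x, Integrable (fun y => S b x y * S c x y) lam := fun b c x =>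
    Integrable.of_bound ((hSx b x).mul (hSx c x)).aestronglyMeasurable 1 (ae_of_all _ fun y => by
      rw [norm_mul]; exact mul_le_one₀ (hS1 _ _ _) (norm_nonneg _) (hS1 _ _ _))
  have hsum1 : ∀ x, ‖∑ b ∈ B, m b x‖ ≤ B.card := fun x =>
    (norm_sum_le _ _).trans ((Finset.sum_le_sum fun b hb => hm1 b hb x).trans (by simp))
  have hsumS : ∀ z : γ × δ, ‖∑ b ∈ B, S b z.1 z.2‖ ≤ B.card := fun z =>
    (norm_sum_le _ _).trans ((Finset.sum_le_sum fun b _ => hS1 b z.1 z.2).trans (by simp))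
  have hMm : Measurable fun x => ∑ b ∈ B, m b x := Finset.measurable_sum _ hmB
  have hSm : Measurable fun z : γ × δ => ∑ b ∈ B, S b z.1 z.2 :=
    Finset.measurable_sum _ fun b _ => hS b
  have hM2 := memLp_two_of_bound ν hMm hsum1
  have hS2 := memLp_two_of_bound (ν.prod lam) hSm hsumS
  have hdint : ∀ b ∈ B, Integrable (fun x => m b x - m b x ^ 2) ν := fun b hb =>
    (Integrable.of_bound (hmB b hb).aestronglyMeasurable 1 (ae_of_all _ (hm1 b hb))).sub
      (memLp_two_of_bound ν (hmB b hb) (hm1 b hb)).integrable_sq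
  have hmean : ∫ z : γ × δ, ∑ b ∈ B, S b z.1 z.2 ∂(ν.prod lam) = ∫ x, ∑ b ∈ B, m b x ∂ν := by
    rw [integral_prod _ (hS2.integrable (by norm_num))]
    refine integral_congr_ae (ae_of_all _ fun x => ?_)
    simp only
    rw [integral_finsetSum _ fun b _ =>
      Integrable.of_bound (hSx b x).aestronglyMeasurable 1 (ae_of_all _ (hS1 b x))]
    exact Finset.sum_congr rfl fun b hb => hm b hb x
  have hpt : ∀ x, (∑ b ∈ B, m b x) ^ 2 + ∑ b ∈ B, (m b x - m b x ^ 2)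
      ≤ ∫ y, (∑ b ∈ B, S b x y) ^ 2 ∂lam := fun x => by
    simp_rw [pow_two (∑ b ∈ B, S b x _), Finset.sum_mul_sum]
    rw [integral_finsetSum _ fun b _ => integrable_finsetSum _ fun c _ => hSint b c x,
      pow_two, Finset.sum_mul_sum, ← Finset.sum_add_distrib]
    refine Finset.sum_le_sum fun b hb => ?_
    rw [integral_finsetSum _ fun c _ => hSint b c x]
    have : m b x - m b x ^ 2 = ∑ c ∈ B, if b = c then m b x - m b x ^ 2 else 0 := by
      simp [hb]
    rw [this, ← Finset.sum_add_distrib]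
    refine Finset.sum_le_sum fun c hc => ?_
    split_ifs with hbc
    · subst hbc
      simp_rw [hSS, hm b hb]
      exact (by ring : m b x * m b x + (m b x - m b x ^ 2) = m b x).le
    · simpa using hmm b hb c hc x
  rw [variance_eq_sub hM2, variance_eq_sub hS2]
  simp only [Pi.pow_apply]
  rw [hmean, integral_prod _ hS2.integrable_sq, ← integral_finsetSum _ hdint]
  have hle := integral_mono (μ := ν)
    (hM2.integrable_sq.add (integrable_finsetSum _ hdint)) hS2.integrable_sq.integral_prod_left hpt
  rw [integral_add' hM2.integrable_sq (integrable_finsetSum _ hdint)] at hle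
  linarith

theorem integral_prod_indicator_le {E : Type*} [Fintype E] (A : Finset E) (r : E → ℝ)
    (hr : ∀ e, r e ∈ Set.Icc (0 : ℝ) 1) :
    ∫ y : E → ℝ, ∏ e ∈ A, (if y e ≤ r e then (1 : ℝ) else 0)
      ∂(Measure.pi fun _ => volume.restrict (Set.Icc (0 : ℝ) 1)) = ∏ e ∈ A, r e := by
  classical
  have hA : ∀ f : E → ℝ, ∏ e ∈ A, f e = ∏ e, if e ∈ A then f e else 1 := fun f => by simp
  simp_rw [hA]
  rw [integral_fintype_prod_eq_prod (𝕜 := ℝ)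
    (f := fun e (t : ℝ) => if e ∈ A then (if t ≤ r e then (1 : ℝ) else 0) else 1)]
  refine Finset.prod_congr rfl fun e _ => ?_
  split_ifs
  · have : (fun t : ℝ => if t ≤ r e then (1 : ℝ) else 0) = (Set.Iic (r e)).indicator 1 := by
      ext t; simp [Set.indicator_apply]
    rw [this, integral_indicator_one measurableSet_Iic, measureReal_restrict_apply measurableSet_Iic]
    have : Set.Iic (r e) ∩ Set.Icc 0 1 = Set.Icc 0 (r e) := by
      ext t; simp only [Set.mem_inter_iff, Set.mem_Iic, Set.mem_Icc]
      have := (hr e).2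
      constructor
      · rintro ⟨h1, h2, _⟩; exact ⟨h2, h1⟩
      · rintro ⟨h1, h2⟩; exact ⟨h2, h1, h2.trans this⟩
    rw [this]
    simp [(hr e).1]
  · simp

theorem prod_mul_prod_le_prod_union {E : Type*} [DecidableEq E] (A B : Finset E) (r : E → ℝ)
    (hr : ∀ e, r e ∈ Set.Icc (0 : ℝ) 1) :
    (∏ e ∈ A, r e) * ∏ e ∈ B, r e ≤ ∏ e ∈ A ∪ B, r e := by
  rw [← Finset.prod_union_inter]
  exact mul_le_of_le_one_right (Finset.prod_nonneg fun e _ => (hr e).1)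
    (Finset.prod_le_one (fun e _ => (hr e).1) fun e _ => (hr e).2)

theorem prod_indicator_mul_prod_indicator {E : Type*} [DecidableEq E] (A B : Finset E)
    (Q : E → Prop) [DecidablePred Q] :
    (∏ e ∈ A, if Q e then (1 : ℝ) else 0) * (∏ e ∈ B, if Q e then (1 : ℝ) else 0)
      = ∏ e ∈ A ∪ B, if Q e then (1 : ℝ) else 0 := by
  simp only [Finset.prod_ite_zero, Finset.prod_const_one, Finset.mem_union]
  split_ifs <;> grind

end VarianceBounds

section Projection

variable {α : Type*} [MeasurableSpace α]

/-- The sum over all coordinates `ℓ` of the conditional expectation of `W` given that the `ℓ`-th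
coordinate equals `x`. -/
noncomputable def sumProjection {κ : Type*} [Fintype κ] [DecidableEq κ] (μ : Measure α)
    (W : (κ → α) → ℝ) (x : α) : ℝ :=
  ∑ ℓ, ∫ z, W (Function.update z ℓ x) ∂(Measure.pi fun _ => μ)

variable {ι κ : Type*} [Fintype ι] [DecidableEq ι] [Fintype κ] [DecidableEq κ]

theorem measurable_sumProjection (μ : Measure α) [IsProbabilityMeasure μ] {W : (κ → α) → ℝ}
    (hW : Measurable W) : Measurable (sumProjection μ W) :=
  Finset.measurable_sum _ fun ℓ _ => measurable_integral_update μ ℓ hW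

theorem norm_sumProjection_le (μ : Measure α) [IsProbabilityMeasure μ] {W : (κ → α) → ℝ}
    {C : ℝ} (hC : ∀ z, ‖W z‖ ≤ C) (x : α) :
    ‖sumProjection μ W x‖ ≤ Fintype.card κ * C :=
  (norm_sum_le _ _).trans ((Finset.sum_le_sum fun _ _ =>
    norm_integral_le_of_bound _ fun _ => hC _).trans (by simp))

theorem sum_covariance_comp_injective (μ : Measure α) [IsProbabilityMeasure μ]
    {W : (κ → α) → ℝ} (hW : Measurable W) {C : ℝ} (hC : ∀ z, ‖W z‖ ≤ C)
    {β : κ → ι} (hβ : Function.Injective β) :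
    ∑ i, cov[fun x : ι → α => W fun a => x (β a), fun x => sumProjection μ W (x i);
      Measure.pi fun _ => μ] = Var[sumProjection μ W; μ] := by
  have hg := measurable_sumProjection μ hW
  have hgC := norm_sumProjection_le μ hC
  have hWβ : Measurable fun x : ι → α => W fun a => x (β a) := hW.comp (by fun_prop)
  have hcov : ∀ i, cov[fun x : ι → α => W fun a => x (β a), fun x => sumProjection μ W (x i);
      Measure.pi fun _ => μ] = cov[fun t => ∫ x, W (fun a => Function.update x i t (β a))
        ∂(Measure.pi fun _ : ι => μ), sumProjection μ W; μ] := fun i =>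
    covariance_pi_eval μ i hWβ (fun _ => hC _) hg hgC
  have hout : ∀ i, i ∉ Finset.univ.image β → cov[fun x : ι → α => W fun a => x (β a),
      fun x => sumProjection μ W (x i); Measure.pi fun _ => μ] = 0 := fun i hi => by
    have : ∀ a, β a ≠ i := fun a h => hi (by simp [← h])
    rw [hcov]
    simp only [Function.update_of_ne (this _)]
    exact covariance_const_left _
  rw [← Finset.sum_subset (Finset.subset_univ (Finset.univ.image β)) fun i _ hi => hout i hi,
    Finset.sum_image fun a _ b _ h => hβ h, ← covariance_self hg.aemeasurable]
  have hin : ∀ ℓ, cov[fun x : ι → α => W fun a => x (β a),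
      fun x => sumProjection μ W (x (β ℓ)); Measure.pi fun _ => μ]
      = cov[fun t => ∫ z, W (Function.update z ℓ t) ∂(Measure.pi fun _ => μ),
          sumProjection μ W; μ] := fun ℓ => by
    rw [hcov]
    congr 1
    ext t
    have hmp := measurePreserving_comp_injective (ι := ι) μ hβ
    rw [← hmp.map_eq, integral_map hmp.measurable.aemeasurable
      (f := fun z => W (Function.update z ℓ t))
      (hW.comp measurable_update_left).aestronglyMeasurable]
    refine integral_congr_ae (ae_of_all _ fun x => ?_)
    simp only
    congr 1
    ext a
    rcases eq_or_ne a ℓ with rfl | h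
    · simp
    · simp [h, hβ.ne h]
  simp_rw [hin]
  rw [← covariance_fun_sum_left (fun ℓ => memLp_two_of_bound μ (measurable_integral_update μ ℓ hW)
    fun x => norm_integral_le_of_bound _ fun z => hC _) (memLp_two_of_bound μ hg hgC)]
  rfl

/-- The variance of a sum over injective index maps dominates that of its projection onto sums of
functions of single coordinates. -/
theorem card_sq_mul_variance_sumProjection_le (μ : Measure α) [IsProbabilityMeasure μ] [Nonempty ι]
    {W : (κ → α) → ℝ} (hW : Measurable W) {C : ℝ} (hC : ∀ z, ‖W z‖ ≤ C)
    (B : Finset (κ → ι)) (hB : ∀ β ∈ B, Function.Injective β) :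
    (B.card : ℝ) ^ 2 * Var[sumProjection μ W; μ] ≤ Fintype.card ι *
      Var[fun x : ι → α => ∑ β ∈ B, W fun a => x (β a); Measure.pi fun _ => μ] := by
  have hg := measurable_sumProjection μ hW
  have hgC := norm_sumProjection_le μ hC
  have hWβ : ∀ β ∈ B, MemLp (fun x : ι → α => W fun a => x (β a)) 2 (Measure.pi fun _ => μ) :=
    fun β _ => memLp_two_of_bound _ (hW.comp (by fun_prop)) fun _ => hC _
  have hgi : ∀ i ∈ (Finset.univ : Finset ι), MemLp (fun x : ι → α => sumProjection μ W (x i)) 2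
      (Measure.pi fun _ => μ) := fun i _ =>
    memLp_two_of_bound _ (hg.comp (measurable_pi_apply i)) fun _ => hgC _
  have hM := memLp_finsetSum B hWβ
  have hT := memLp_finsetSum Finset.univ hgi
  have hcov : cov[fun x : ι → α => ∑ β ∈ B, W fun a => x (β a),
      fun x => ∑ i, sumProjection μ W (x i); Measure.pi fun _ => μ]
      = B.card * Var[sumProjection μ W; μ] := by
    rw [covariance_fun_sum_fun_sum' hWβ hgi,
      Finset.sum_congr rfl fun β hβ => sum_covariance_comp_injective μ hW hC (hB β hβ)]
    simp
  have hvar : Var[fun x : ι → α => ∑ i, sumProjection μ W (x i); Measure.pi fun _ => μ]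
      = Fintype.card ι * Var[sumProjection μ W; μ] := by
    have := variance_sum_pi (μ := fun _ : ι => μ) (X := fun _ => sumProjection μ W)
      fun _ => memLp_two_of_bound μ hg hgC
    simp only [Finset.sum_const, Finset.card_univ, nsmul_eq_mul] at this
    rw [← this]
    congr 1
    ext x
    simp
  have hn : (0 : ℝ) < Fintype.card ι := by exact_mod_cast Fintype.card_pos
  have h0 := variance_nonneg (fun x : ι → α => (Fintype.card ι : ℝ) * (∑ β ∈ B, W fun a => x (β a))
    - (B.card : ℝ) * ∑ i, sumProjection μ W (x i)) (Measure.pi fun _ => μ)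
  rw [variance_fun_sub (hM.const_mul _) (hT.const_mul _), variance_const_mul, variance_const_mul,
    covariance_const_mul_left, covariance_const_mul_right, hcov, hvar] at h0
  refine le_of_mul_le_mul_left ?_ hn
  nlinarith

end Projection

section GraphWeights

variable {k n : ℕ} (G : SimpleGraph (Fin k)) [DecidableRel G.Adj]

/-- The product of a weight over the edges of `G`. -/
def edgeProd (w : Fin k → Fin k → ℝ) : ℝ :=
  ∏ q ∈ (Finset.univ : Finset (Fin k × Fin k)).filter (fun q => q.1 < q.2 ∧ G.Adj q.1 q.2),
    w q.1 q.2

/-- The edges of the image of `G` under the vertex map `β`, as increasing pairs. -/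
def copyEdges (β : Fin k → Fin n) : Finset {q : Fin n × Fin n // q.1 < q.2} :=
  Finset.univ.filter fun e => ∃ a b, G.Adj a b ∧ β a = e.1.1 ∧ β b = e.1.2

theorem edgeProd_comp_injective {β : Fin k → Fin n} (hβ : Function.Injective β)
    {w : Fin n → Fin n → ℝ} (hw : ∀ i j, w i j = w j i) :
    edgeProd G (fun a b => w (β a) (β b)) = ∏ e ∈ copyEdges G β, w e.1.1 e.1.2 := by
  have hlt : ∀ q : Fin k × Fin k, q.1 < q.2 → ¬ β q.1 < β q.2 → β q.2 < β q.1 :=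
    fun q h h' => lt_of_le_of_ne (not_lt.1 h') (hβ.ne h.ne')
  refine Finset.prod_bij (fun q hq => if h : β q.1 < β q.2 then ⟨(β q.1, β q.2), h⟩
    else ⟨(β q.2, β q.1), hlt q (Finset.mem_filter.1 hq).2.1 h⟩) ?_ ?_ ?_ ?_
  · intro q hq
    have hq' := (Finset.mem_filter.1 hq).2
    simp only [copyEdges, Finset.mem_filter, Finset.mem_univ, true_and]
    split_ifs with h
    · exact ⟨q.1, q.2, hq'.2, rfl, rfl⟩
    · exact ⟨q.2, q.1, hq'.2.symm, rfl, rfl⟩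
  · intro q hq r hr h
    have hq' := (Finset.mem_filter.1 hq).2.1
    have hr' := (Finset.mem_filter.1 hr).2.1
    split_ifs at h <;>
    · simp only [Subtype.mk.injEq, Prod.mk.injEq, hβ.eq_iff] at h
      first
        | exact Prod.ext h.1 h.2
        | exact Prod.ext h.2 h.1
        | (rw [h.1, h.2] at hq'; exact absurd hq' hr'.asymm)
  · intro e he
    obtain ⟨a, b, hab, ha, hb⟩ := (Finset.mem_filter.1 he).2
    have he := e.2
    rcases lt_or_gt_of_ne hab.ne with h | h
    · refine ⟨(a, b), by simp [h, hab], ?_⟩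
      have h' : β a < β b := by rw [ha, hb]; exact he
      simp only [h', dif_pos]
      exact Subtype.ext (Prod.ext ha hb)
    · refine ⟨(b, a), by simp [h, hab.symm], ?_⟩
      have h' : ¬ β b < β a := by rw [ha, hb]; exact he.asymm
      simp only [h', dif_neg, not_false_iff]
      exact Subtype.ext (Prod.ext ha hb)
  · intro q hq
    split_ifs
    · rfl
    · exact hw _ _

theorem card_increasing_adj :
    ((Finset.univ : Finset (Fin k × Fin k)).filter
      (fun q => q.1 < q.2 ∧ G.Adj q.1 q.2)).card = G.edgeFinset.card := by
  refine Finset.card_bij (fun q _ => s(q.1, q.2)) ?_ ?_ ?_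
  · intro q hq
    simpa using (Finset.mem_filter.1 hq).2.2
  · intro q hq r hr h
    have hq' := (Finset.mem_filter.1 hq).2.1
    have hr' := (Finset.mem_filter.1 hr).2.1
    rcases Sym2.eq_iff.1 h with h | h
    · exact Prod.ext h.1 h.2
    · rw [h.1, h.2] at hq'
      exact absurd hq' hr'.asymm
  · intro e he
    induction e with
    | h a b =>
      have hab : G.Adj a b := by simpa using he
      rcases lt_or_gt_of_ne hab.ne with h | h
      · exact ⟨(a, b), by simp [h, hab], rfl⟩
      · exact ⟨(b, a), by simp [h, hab.symm], Sym2.eq_swap⟩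

theorem edgeProd_const_mul (c : ℝ) (w : Fin k → Fin k → ℝ) :
    edgeProd G (fun a b => c * w a b) = c ^ G.edgeFinset.card * edgeProd G w := by
  rw [edgeProd, Finset.prod_mul_distrib, Finset.prod_const, card_increasing_adj, edgeProd]

theorem edgeProd_mem_Icc {w : Fin k → Fin k → ℝ} (hw : ∀ a b, w a b ∈ Set.Icc (0 : ℝ) 1) :
    edgeProd G w ∈ Set.Icc (0 : ℝ) 1 :=
  ⟨Finset.prod_nonneg fun _ _ => (hw _ _).1,
    Finset.prod_le_one (fun _ _ => (hw _ _).1) fun _ _ => (hw _ _).2⟩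

end GraphWeights

theorem card_filter_injective_fin (k n : ℕ) :
    ((Finset.univ : Finset (Fin k → Fin n)).filter Function.Injective).card
      = n.descFactorial k := by
  rw [← Fintype.card_subtype, Fintype.card_congr (Equiv.subtypeInjectiveEquivEmbedding _ _),
    Fintype.card_embedding_eq, Fintype.card_fin, Fintype.card_fin]

theorem mul_descFactorial_two_mul_sub_one_le {k n : ℕ} (hk : 1 ≤ k) (hn : 1 ≤ n) :
    n * n.descFactorial (2 * k - 1) ≤ n.descFactorial k ^ 2 := by
  rw [← Nat.descFactorial_mul_descFactorial (show k ≤ 2 * k - 1 by lia),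
    show 2 * k - 1 - k = k - 1 by lia]
  have h1 : n.descFactorial k = n * (n - 1).descFactorial (k - 1) := by
    obtain ⟨m, rfl⟩ := Nat.exists_eq_add_of_le' hn
    obtain ⟨l, rfl⟩ := Nat.exists_eq_add_of_le' hk
    exact Nat.succ_descFactorial_succ m l
  have h2 : (n - k).descFactorial (k - 1) ≤ (n - 1).descFactorial (k - 1) :=
    Nat.descFactorial_le _ (by lia)
  calc n * ((n - k).descFactorial (k - 1) * n.descFactorial k)
      = n * (n - k).descFactorial (k - 1) * n.descFactorial k := by ring
    _ ≤ n * (n - 1).descFactorial (k - 1) * n.descFactorial k := by gcongr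
    _ = n.descFactorial k ^ 2 := by rw [← h1]; ring

theorem descFactorial_le_descFactorial_two_mul_sub_one {k n : ℕ} (hk : 1 ≤ k)
    (hn : 2 * k - 1 ≤ n) : n.descFactorial k ≤ n.descFactorial (2 * k - 1) := by
  rw [← Nat.descFactorial_mul_descFactorial (show k ≤ 2 * k - 1 by lia)]
  exact Nat.le_mul_of_pos_left _ (Nat.pos_of_ne_zero
    (mt Nat.descFactorial_eq_zero_iff_lt.1 (by lia)))

section ConnectionModel

variable {α : Type*} {k n : ℕ} (G : SimpleGraph (Fin k)) [DecidableRel G.Adj]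

/-- The product of the connection function over the edges of `G`. -/
def connProd (H : α → α → ℝ) (z : Fin k → α) : ℝ :=
  edgeProd G fun a b => H (z a) (z b)

/-- The indicator that the copy of `G` at the vertices `β` is present, given vertex locations `x`
and edge marks `y`. -/
noncomputable def copyIndicator (H : α → α → ℝ) (p : ℝ) (β : Fin k → Fin n) (x : Fin n → α)
    (y : {q : Fin n × Fin n // q.1 < q.2} → ℝ) : ℝ :=
  ∏ e ∈ copyEdges G β, if y e ≤ p * H (x e.1.1) (x e.1.2) then (1 : ℝ) else 0

theorem measurable_connProd [MeasurableSpace α] {H : α → α → ℝ} (hHm : Measurable fun z : α × α => H z.1 z.2) :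
    Measurable (connProd G H) :=
  Finset.measurable_prod _ fun q _ =>
    hHm.comp (g := fun z : α × α => H z.1 z.2) (f := fun z : Fin k → α => (z q.1, z q.2))
      (by fun_prop)

theorem connProd_mem_Icc {H : α → α → ℝ} (hH01 : ∀ x y, H x y ∈ Set.Icc (0 : ℝ) 1)
    (z : Fin k → α) : connProd G H z ∈ Set.Icc (0 : ℝ) 1 :=
  edgeProd_mem_Icc G fun _ _ => hH01 _ _

theorem norm_connProd_le {H : α → α → ℝ} (hH01 : ∀ x y, H x y ∈ Set.Icc (0 : ℝ) 1)
    (z : Fin k → α) : ‖connProd G H z‖ ≤ 1 := by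
  rw [Real.norm_of_nonneg (connProd_mem_Icc G hH01 z).1]
  exact (connProd_mem_Icc G hH01 z).2

theorem measurable_copyIndicator [MeasurableSpace α] {H : α → α → ℝ}
    (hHm : Measurable fun z : α × α => H z.1 z.2) (p : ℝ) (β : Fin k → Fin n) :
    Measurable fun z : (Fin n → α) × ({q : Fin n × Fin n // q.1 < q.2} → ℝ) =>
      copyIndicator G H p β z.1 z.2 := by
  refine Finset.measurable_prod _ fun e _ => Measurable.ite ?_ measurable_const measurable_const
  refine measurableSet_le ((measurable_pi_apply e).comp measurable_snd) (Measurable.const_mul ?_ p)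
  exact hHm.comp (g := fun z : α × α => H z.1 z.2)
    (f := fun z : (Fin n → α) × ({q : Fin n × Fin n // q.1 < q.2} → ℝ) =>
      (z.1 e.1.1, z.1 e.1.2)) (by fun_prop)

theorem norm_copyIndicator_le (H : α → α → ℝ) (p : ℝ) (β : Fin k → Fin n) (x : Fin n → α)
    (y : {q : Fin n × Fin n // q.1 < q.2} → ℝ) : ‖copyIndicator G H p β x y‖ ≤ 1 := by
  rw [copyIndicator, Finset.prod_ite_zero]
  split_ifs <;> simp

theorem copyIndicator_mul (H : α → α → ℝ) (p : ℝ) (β γ : Fin k → Fin n) (x : Fin n → α)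
    (y : {q : Fin n × Fin n // q.1 < q.2} → ℝ) :
    copyIndicator G H p β x y * copyIndicator G H p γ x y
      = ∏ e ∈ copyEdges G β ∪ copyEdges G γ,
          if y e ≤ p * H (x e.1.1) (x e.1.2) then (1 : ℝ) else 0 :=
  prod_indicator_mul_prod_indicator _ _ fun e => y e ≤ p * H (x e.1.1) (x e.1.2)

theorem prod_copyEdges_conn {H : α → α → ℝ} (hHsym : ∀ x y, H x y = H y x) (p : ℝ)
    {β : Fin k → Fin n} (hβ : Function.Injective β) (x : Fin n → α) :
    ∏ e ∈ copyEdges G β, p * H (x e.1.1) (x e.1.2)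
      = p ^ G.edgeFinset.card * connProd G H fun a => x (β a) := by
  rw [← edgeProd_comp_injective G hβ (w := fun i j => p * H (x i) (x j))
    fun i j => by rw [hHsym], edgeProd_const_mul]
  rfl

theorem variance_sum_copyIndicator_ge [MeasurableSpace α] (μ : Measure α)
    [IsProbabilityMeasure μ] {H : α → α → ℝ}
    (hHm : Measurable fun z : α × α => H z.1 z.2) (hHsym : ∀ x y, H x y = H y x)
    (hH01 : ∀ x y, H x y ∈ Set.Icc (0 : ℝ) 1) {p : ℝ} (hp : p ∈ Set.Ioo (0 : ℝ) 1)
    (hG : G.edgeFinset.card ≠ 0) (B : Finset (Fin k → Fin n))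
    (hB : ∀ β ∈ B, Function.Injective β) :
    (p ^ G.edgeFinset.card) ^ 2 * Var[fun x : Fin n → α => ∑ β ∈ B, connProd G H fun a => x (β a);
        Measure.pi fun _ => μ]
      + B.card * ((1 - p) * (p ^ G.edgeFinset.card * ∫ z, connProd G H z ∂(Measure.pi fun _ => μ)))
      ≤ Var[fun z : (Fin n → α) × ({q : Fin n × Fin n // q.1 < q.2} → ℝ) =>
          ∑ β ∈ B, copyIndicator G H p β z.1 z.2;
        (Measure.pi fun _ => μ).prod
          (Measure.pi fun _ => (volume.restrict (Set.Icc (0 : ℝ) 1)))] := by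
  have : IsProbabilityMeasure (volume.restrict (Set.Icc (0 : ℝ) 1)) := ⟨by simp⟩
  set c := p ^ G.edgeFinset.card with hc
  have hc0 : 0 < c := pow_pos hp.1 _
  have hcp : c ≤ p := pow_le_of_le_one hp.1.le hp.2.le hG
  have hpH : ∀ (x : Fin n → α) (e : {q : Fin n × Fin n // q.1 < q.2}),
      p * H (x e.1.1) (x e.1.2) ∈ Set.Icc (0 : ℝ) 1 := fun x e =>
    ⟨mul_nonneg hp.1.le (hH01 _ _).1, mul_le_one₀ hp.2.le (hH01 _ _).1 (hH01 _ _).2⟩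
  have hWm := measurable_connProd G hHm
  have hWβ : ∀ β : Fin k → Fin n, Measurable fun x : Fin n → α => connProd G H fun a => x (β a) :=
    fun β => hWm.comp (by fun_prop)
  have key := variance_prod_ge_of_condMoments (Measure.pi fun _ : Fin n => μ)
    (Measure.pi fun _ : {q : Fin n × Fin n // q.1 < q.2} => volume.restrict (Set.Icc (0 : ℝ) 1))
    B (copyIndicator G H p) (fun β x => c * connProd G H fun a => x (β a))
    (measurable_copyIndicator G hHm p) (norm_copyIndicator_le G H p)
    (fun β x y => by rw [copyIndicator_mul, Finset.union_idempotent, copyIndicator])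
    (fun β hβ x => by
      rw [← prod_copyEdges_conn G hHsym p (hB β hβ)]
      exact integral_prod_indicator_le _ _ (hpH x))
    (fun β hβ γ hγ x => by
      rw [← prod_copyEdges_conn G hHsym p (hB β hβ), ← prod_copyEdges_conn G hHsym p (hB γ hγ)]
      simp_rw [copyIndicator_mul]
      rw [integral_prod_indicator_le _ _ (hpH x)]
      exact prod_mul_prod_le_prod_union _ _ _ (hpH x))
  refine le_trans (add_le_add ?_ ?_) key
  · simp_rw [← Finset.mul_sum]
    rw [variance_const_mul]
  · rw [← nsmul_eq_mul]
    refine Finset.card_nsmul_le_sum _ _ _ fun β hβ => ?_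
    have hmp := measurePreserving_comp_injective (ι := Fin n) μ (hB β hβ)
    rw [← hmp.map_eq, integral_map hmp.measurable.aemeasurable hWm.aestronglyMeasurable,
      ← integral_const_mul, ← integral_const_mul]
    have hint : Integrable (fun x : Fin n → α => connProd G H fun a => x (β a))
        (Measure.pi fun _ => μ) :=
      Integrable.of_bound (hWβ β).aestronglyMeasurable 1
        (ae_of_all _ fun x => norm_connProd_le G hH01 _)
    refine integral_mono ((hint.const_mul _).const_mul _) ((hint.const_mul _).sub
      ((memLp_two_of_bound _ (hWβ β) fun x => norm_connProd_le G hH01 _).const_mul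
        c).integrable_sq) fun x => ?_
    have h := connProd_mem_Icc G hH01 fun a => x (β a)
    have h1 : c * connProd G H (fun a => x (β a)) ≤ p :=
      (mul_le_of_le_one_right hc0.le h.2).trans hcp
    have h0 : 0 ≤ c * connProd G H (fun a => x (β a)) := mul_nonneg hc0.le h.1
    simp only
    nlinarith

theorem integral_pos_of_variance_sumProjection_pos [MeasurableSpace α] {κ : Type*} [Fintype κ]
    [DecidableEq κ] (μ : Measure α) [IsProbabilityMeasure μ] {W : (κ → α) → ℝ} (hW : Measurable W)
    (hW01 : ∀ z, W z ∈ Set.Icc (0 : ℝ) 1) (hvar : 0 < Var[sumProjection μ W; μ]) :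
    0 < ∫ z, W z ∂(Measure.pi fun _ => μ) := by
  have hW0 : ∀ z, 0 ≤ W z := fun z => (hW01 z).1
  have hW1 : ∀ z, ‖W z‖ ≤ 1 := fun z => by
    rw [Real.norm_of_nonneg (hW0 z)]; exact (hW01 z).2
  refine (integral_nonneg hW0).lt_of_ne' fun h0 => hvar.ne' ?_
  have hproj : ∀ ℓ, (fun x => ∫ z, W (Function.update z ℓ x) ∂(Measure.pi fun _ : κ => μ))
      =ᵐ[μ] 0 := fun ℓ => by
    refine (integral_eq_zero_iff_of_nonneg (fun x => integral_nonneg fun z => hW0 _) ?_).1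
      ((integral_pi_update μ ℓ hW hW1).trans h0)
    exact Integrable.of_bound (measurable_integral_update μ ℓ hW).aestronglyMeasurable 1
      (ae_of_all _ fun x => norm_integral_le_of_bound _ fun z => hW1 _)
  have : sumProjection μ W =ᵐ[μ] 0 := by
    filter_upwards [ae_all_iff.2 hproj] with x hx
    exact Finset.sum_eq_zero fun ℓ _ => hx ℓ
  rw [variance_congr this, variance_zero]

end ConnectionModel

theorem NG_eq_sum_copyIndicator {d k n : ℕ} {Ω : Type*} (G : SimpleGraph (Fin k))
    [DecidableRel G.Adj] {H : (Fin d → ℝ) → (Fin d → ℝ) → ℝ} (hHsym : ∀ x y, H x y = H y x)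
    (pn : ℝ) (aG : ℕ) (X : Fin n → Ω → (Fin d → ℝ)) {Y : Fin n → Fin n → Ω → ℝ}
    (hYsym : ∀ a b, Y a b = Y b a) (ω : Ω) :
    NG G H pn aG X Y ω = (aG : ℝ)⁻¹ *
      ∑ β ∈ (Finset.univ : Finset (Fin k → Fin n)).filter Function.Injective,
        copyIndicator G H pn β (fun i => X i ω) fun q => Y q.1.1 q.1.2 ω := by
  rw [NG]
  congr 1
  refine Finset.sum_congr rfl fun β hβ => ?_
  exact edgeProd_comp_injective G (Finset.mem_filter.1 hβ).2
    (w := fun i j => if Y i j ω ≤ pn * H (X i ω) (X j ω) then (1 : ℝ) else 0)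
    fun i j => by rw [hYsym, hHsym]

theorem sum_fSub {d k : ℕ} (G : SimpleGraph (Fin k)) [DecidableRel G.Adj]
    (H : (Fin d → ℝ) → (Fin d → ℝ) → ℝ) (μ : Measure (Fin d → ℝ)) (pn : ℝ) (aG : ℕ)
    (x : Fin d → ℝ) :
    ∑ ℓ, fSub G H μ pn aG ℓ x
      = pn ^ G.edgeFinset.card / (aG : ℝ) * sumProjection μ (connProd G H) x := by
  simp only [fSub, ← Finset.mul_sum]
  rfl

theorem min_mul_add_le {σ θ p P Q V : ℝ} {e : ℕ} (hσ : 0 < σ) (hθ : 0 < θ) (hp0 : 0 < p)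
    (hp1 : p < 1) (hP : 0 ≤ P) (hPQ : Q ≤ P) (hQ : 0 ≤ Q)
    (hV : σ * (P * p ^ (2 * e)) + (1 - p) * θ * (Q * p ^ e) ≤ V) :
    min (σ / (1 + 2 ^ e)) (θ / 2) * (P * p ^ (2 * e) + Q * p ^ e) ≤ V := by
  have h2 : (0 : ℝ) < 2 ^ e := by positivity
  have hpe : 0 < p ^ e := pow_pos hp0 e
  have hA : 0 ≤ P * p ^ (2 * e) := by positivity
  have hB : 0 ≤ Q * p ^ e := by positivity
  refine le_trans ?_ hV
  rcases le_total p (1 / 2) with h | h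
  · have h1 : σ / (1 + 2 ^ e) ≤ σ := div_le_self hσ.le (by linarith)
    have h3 : θ / 2 ≤ (1 - p) * θ := by nlinarith
    rw [mul_add]
    exact add_le_add (mul_le_mul_of_nonneg_right ((min_le_left _ _).trans h1) hA)
      (mul_le_mul_of_nonneg_right ((min_le_right _ _).trans h3) hB)
  · have hbig : 1 ≤ 2 ^ e * p ^ e := by
      rw [← mul_pow]; exact one_le_pow₀ (by linarith)
    have hQP : Q * p ^ e ≤ 2 ^ e * (P * p ^ (2 * e)) := by
      calc Q * p ^ e ≤ P * p ^ e := by gcongr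
        _ ≤ P * p ^ e * (2 ^ e * p ^ e) := le_mul_of_one_le_right (by positivity) hbig
        _ = 2 ^ e * (P * p ^ (2 * e)) := by ring
    calc min (σ / (1 + 2 ^ e)) (θ / 2) * (P * p ^ (2 * e) + Q * p ^ e)
        ≤ σ / (1 + 2 ^ e) * ((1 + 2 ^ e) * (P * p ^ (2 * e))) := by
          refine mul_le_mul (min_le_left _ _) (by linarith) (by positivity) (by positivity)
      _ = σ * (P * p ^ (2 * e)) := by field_simp
      _ ≤ _ := by
          have : 0 ≤ (1 - p) * θ := mul_nonneg (by linarith) hθ.le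
          nlinarith [mul_nonneg this hB]

/-- Variance lower bound for subgraph counts in the binomial random-connection model:
under Assumption 1 there is a constant `C > 0` independent of `n` such that for all
`n ≥ 2k−1`, `Var(N_G) ≥ (C/a(G)²)((n!/(n−2k+1)!) p_n^{2e(G)} + (n!/(n−k)!) p_n^{e(G)})`
(the quotients of factorials being falling factorials). -/
theorem variance_lower_bound_subgraph_count
    {d k : ℕ} (hk : 2 ≤ k)
    (G : SimpleGraph (Fin k)) [DecidableRel G.Adj] (hGconn : G.Connected)
    (μ : Measure (Fin d → ℝ)) [IsProbabilityMeasure μ] (hμ : ∀ x, μ {x} = 0)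
    (H : (Fin d → ℝ) → (Fin d → ℝ) → ℝ)
    (hHm : Measurable fun z : (Fin d → ℝ) × (Fin d → ℝ) => H z.1 z.2)
    (hHsym : ∀ x y, H x y = H y x) (hH01 : ∀ x y, H x y ∈ Set.Icc (0 : ℝ) 1)
    (p : ℕ → ℝ) (hp : ∀ n, p n ∈ Set.Ioo (0 : ℝ) 1)
    (Ω : ℕ → Type) [∀ n, MeasurableSpace (Ω n)]
    (P : ∀ n, Measure (Ω n)) [∀ n, IsProbabilityMeasure (P n)]
    (X : ∀ n, Fin n → Ω n → (Fin d → ℝ)) (Y : ∀ n, Fin n → Fin n → Ω n → ℝ)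
    (hYsym : ∀ n a b, Y n a b = Y n b a)
    (hlaw : ∀ n, Measure.map (fun ω => ((fun i => X n i ω),
        (fun q : {q : Fin n × Fin n // q.1 < q.2} => Y n q.1.1 q.1.2 ω))) (P n)
      = (Measure.pi fun _ => μ).prod
          (Measure.pi fun _ => (volume.restrict (Set.Icc (0 : ℝ) 1))))
    (hA : ∀ n, 0 < variance
      (fun x => ∑ ℓ : Fin k, fSub G H μ (p n) (autCard G) ℓ x) μ) :
    ∃ C > (0 : ℝ), ∀ n, 2 * k - 1 ≤ n →
      C / (autCard G : ℝ) ^ 2 *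
          ((n.descFactorial (2 * k - 1) : ℝ) * p n ^ (2 * G.edgeFinset.card)
            + (n.descFactorial k : ℝ) * p n ^ G.edgeFinset.card)
        ≤ variance (NG G H (p n) (autCard G) (X n) (Y n)) (P n) := by
  have hek : G.edgeFinset.card ≠ 0 := by
    have : Nontrivial (Fin k) := Fin.nontrivial_iff_two_le.2 hk
    obtain ⟨v, hv⟩ := hGconn.preconnected.exists_adj_of_nontrivial ⟨0, by lia⟩
    exact Finset.card_ne_zero_of_mem (SimpleGraph.mem_edgeFinset.2 (G.mem_edgeSet.2 hv))
  set e := G.edgeFinset.card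
  have hWm := measurable_connProd G hHm
  have hσ : 0 < Var[sumProjection μ (connProd G H); μ] := by
    have h := hA 0
    simp_rw [sum_fSub] at h
    rw [variance_const_mul] at h
    exact pos_of_mul_pos_right h (sq_nonneg _)
  have hθ := integral_pos_of_variance_sumProjection_pos μ hWm (connProd_mem_Icc G hH01) hσ
  refine ⟨min (Var[sumProjection μ (connProd G H); μ] / (1 + 2 ^ e))
    ((∫ z, connProd G H z ∂(Measure.pi fun _ => μ)) / 2), by positivity, fun n hn => ?_⟩
  have : NeZero n := ⟨by lia⟩
  have : IsProbabilityMeasure (volume.restrict (Set.Icc (0 : ℝ) 1)) := ⟨by simp⟩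
  have hΦ : AEMeasurable (fun ω => ((fun i => X n i ω),
      (fun q : {q : Fin n × Fin n // q.1 < q.2} => Y n q.1.1 q.1.2 ω))) (P n) := by
    refine AEMeasurable.of_map_ne_zero ?_
    rw [hlaw]
    exact IsProbabilityMeasure.ne_zero _
  set B := (Finset.univ : Finset (Fin k → Fin n)).filter Function.Injective with hBdef
  have hB : ∀ β ∈ B, Function.Injective β := fun β hβ => (Finset.mem_filter.1 hβ).2
  have hNG : NG G H (p n) (autCard G) (X n) (Y n) = fun ω => (autCard G : ℝ)⁻¹ *
      ((fun z : (Fin n → Fin d → ℝ) × ({q : Fin n × Fin n // q.1 < q.2} → ℝ) =>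
        ∑ β ∈ B, copyIndicator G H (p n) β z.1 z.2) ∘ fun ω => ((fun i => X n i ω),
      (fun q : {q : Fin n × Fin n // q.1 < q.2} => Y n q.1.1 q.1.2 ω))) ω :=
    funext fun ω => NG_eq_sum_copyIndicator G hHsym _ _ _ (hYsym n) ω
  have hSm : Measurable fun z : (Fin n → Fin d → ℝ) × ({q : Fin n × Fin n // q.1 < q.2} → ℝ) =>
      ∑ β ∈ B, copyIndicator G H (p n) β z.1 z.2 :=
    Finset.measurable_sum _ fun β _ => measurable_copyIndicator G hHm (p n) β
  rw [hNG, variance_const_mul, ← variance_map hSm.aemeasurable hΦ, hlaw n, inv_pow,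
    div_mul_eq_mul_div, div_eq_inv_mul]
  refine mul_le_mul_of_nonneg_left ?_ (by positivity)
  have hcard : B.card = n.descFactorial k := card_filter_injective_fin k n
  have h1 := variance_sum_copyIndicator_ge G μ hHm hHsym hH01 (hp n) hek B hB
  have h2 := card_sq_mul_variance_sumProjection_le μ hWm (norm_connProd_le G hH01) B hB
  have h3 : (n : ℝ) * n.descFactorial (2 * k - 1) ≤ (n.descFactorial k : ℝ) ^ 2 := by
    exact_mod_cast mul_descFactorial_two_mul_sub_one_le (by lia) (by lia)
  have h4 : (n.descFactorial k : ℝ) ≤ n.descFactorial (2 * k - 1) := by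
    exact_mod_cast descFactorial_le_descFactorial_two_mul_sub_one (by lia) hn
  rw [hcard] at h1 h2
  rw [Fintype.card_fin] at h2
  have h5 : (n.descFactorial (2 * k - 1) : ℝ) * Var[sumProjection μ (connProd G H); μ]
      ≤ Var[fun x : Fin n → Fin d → ℝ => ∑ β ∈ B, connProd G H fun a => x (β a);
        Measure.pi fun _ => μ] := by
    have hn0 : (0 : ℝ) < n := by exact_mod_cast Nat.pos_of_neZero n
    refine le_of_mul_le_mul_left ?_ hn0
    rw [← mul_assoc]
    exact (mul_le_mul_of_nonneg_right h3 hσ.le).trans h2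
  refine min_mul_add_le hσ hθ (hp n).1 (hp n).2 (by positivity) h4 (by positivity)
    (le_trans ?_ h1)
  have h6 := mul_le_mul_of_nonneg_left h5 (sq_nonneg (p n ^ e))
  rw [mul_comm 2 e, pow_mul]
  linarith
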